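/- Let γ be a real number with γ > 1 and γ^5 = (γ+1)^2, and let v_tet = 3·Λ(π/3) where Λ(θ) = -∫_0^θ log(2 sin t) dt. Then 28.63975 < 10·v_tet/log γ < 28.63977. -/

import Mathlib

/-- The Lobachevsky function `Λ(θ) = -∫_0^θ log (2 sin t) dt`. -/
noncomputable def lob (θ : ℝ) : ℝ := -∫ t in (0:ℝ)..θ, Real.log (2 * Real.sin t)

/-- The volume of the regular ideal hyperbolic tetrahedron. -/
noncomputable def vtet : ℝ := 3 * lob (Real.pi / 3)

open Real Set MeasureTheory

/-- Taylor polynomial of `cos` at `0` with `n` terms. -/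
noncomputable def cosTaylor (n : ℕ) (x : ℝ) : ℝ :=
  ∑ k ∈ Finset.range n, (-1) ^ k * x ^ (2 * k) / (2 * k).factorial

/-- Taylor polynomial of `sin` at `0` with `n` terms. -/
noncomputable def sinTaylor (n : ℕ) (x : ℝ) : ℝ :=
  ∑ k ∈ Finset.range n, (-1) ^ k * x ^ (2 * k + 1) / (2 * k + 1).factorial

lemma hasDerivAt_sinTaylor (n : ℕ) (x : ℝ) :
    HasDerivAt (sinTaylor n) (cosTaylor n x) x := by
  unfold sinTaylor cosTaylor
  refine HasDerivAt.fun_sum fun k _ => ?_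
  refine (((hasDerivAt_pow (2 * k + 1) x).const_mul ((-1 : ℝ) ^ k)).div_const _).congr_deriv ?_
  rw [Nat.factorial_succ]
  have : ((2 * k).factorial : ℝ) ≠ 0 := by positivity
  push_cast
  field_simp

lemma hasDerivAt_cosTaylor (n : ℕ) (x : ℝ) :
    HasDerivAt (cosTaylor (n + 1)) (-sinTaylor n x) x := by
  have h : cosTaylor (n + 1) = fun x => (∑ k ∈ Finset.range n,
      (-1 : ℝ) ^ (k + 1) * x ^ (2 * k + 2) / (2 * k + 2).factorial) + 1 := by
    ext y
    rw [cosTaylor, Finset.sum_range_succ']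
    simp [mul_add]
  rw [h, sinTaylor, ← Finset.sum_neg_distrib]
  refine HasDerivAt.add_const _ (HasDerivAt.fun_sum fun k _ => ?_)
  refine (((hasDerivAt_pow (2 * k + 2) x).const_mul
    ((-1 : ℝ) ^ (k + 1))).div_const _).congr_deriv ?_
  rw [show 2 * k + 2 = (2 * k + 1) + 1 from rfl, Nat.factorial_succ (2 * k + 1)]
  have : ((2 * k + 1).factorial : ℝ) ≠ 0 := by positivity
  push_cast
  field_simp
  simp only [pow_succ]
  ring

lemma nonneg_of_hasDerivAt_nonneg {f f' : ℝ → ℝ} (hf : ∀ x, HasDerivAt f (f' x) x)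
    (h0 : f 0 = 0) (hf' : ∀ x, 0 ≤ x → 0 ≤ f' x) {x : ℝ} (hx : 0 ≤ x) : 0 ≤ f x := by
  have hm : MonotoneOn f (Ici 0) :=
    monotoneOn_of_hasDerivWithinAt_nonneg (convex_Ici 0)
      (fun y _ => (hf y).continuousAt.continuousWithinAt)
      (fun y _ => (hf y).hasDerivWithinAt)
      (fun y hy => hf' y (interior_subset hy))
  simpa [h0] using hm (mem_Ici.2 le_rfl) (mem_Ici.2 hx) hx

lemma neg_one_pow_mul_sin_sub_sinTaylor_nonneg {n : ℕ}
    (hn : ∀ x, 0 ≤ x → 0 ≤ (-1) ^ n * (cos x - cosTaylor n x)) {x : ℝ} (hx : 0 ≤ x) :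
    0 ≤ (-1) ^ n * (sin x - sinTaylor n x) :=
  nonneg_of_hasDerivAt_nonneg
    (fun y => ((hasDerivAt_sin y).sub (hasDerivAt_sinTaylor n y)).const_mul ((-1 : ℝ) ^ n))
    (by simp [sinTaylor]) hn hx

lemma neg_one_pow_mul_cos_sub_cosTaylor_nonneg (n : ℕ) {x : ℝ} (hx : 0 ≤ x) :
    0 ≤ (-1) ^ (n + 1) * (cos x - cosTaylor (n + 1) x) := by
  induction n generalizing x with
  | zero => simp [cosTaylor, cos_le_one]
  | succ n ih =>
    refine nonneg_of_hasDerivAt_nonneg (fun y => ((hasDerivAt_cos y).sub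
      (hasDerivAt_cosTaylor (n + 1) y)).const_mul ((-1 : ℝ) ^ (n + 2))) ?_ ?_ hx
    · simp [cosTaylor, Finset.sum_range_succ']
    · intro y hy
      have := neg_one_pow_mul_sin_sub_sinTaylor_nonneg (n := n + 1) (fun _ h => ih h) hy
      rw [pow_succ]
      linarith

lemma neg_one_pow_succ_mul_sin_sub_sinTaylor_nonneg (n : ℕ) {x : ℝ} (hx : 0 ≤ x) :
    0 ≤ (-1) ^ (n + 1) * (sin x - sinTaylor (n + 1) x) :=
  neg_one_pow_mul_sin_sub_sinTaylor_nonneg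
    (fun _ h => neg_one_pow_mul_cos_sub_cosTaylor_nonneg n h) hx

/-- The Taylor polynomial of degree `10` of `t cot t`, with the extra term `-c t ^ 12`. -/
noncomputable def mulCotApprox (c t : ℝ) : ℝ :=
  1 - t ^ 2 / 3 - t ^ 4 / 45 - 2 * t ^ 6 / 945 - t ^ 8 / 4725 - 2 * t ^ 10 / 93555 - c * t ^ 12

/-- The primitive of `mulCotApprox c` that vanishes at `0`. -/
noncomputable def mulCotApproxPrimitive (c t : ℝ) : ℝ :=
  t - t ^ 3 / 9 - t ^ 5 / 225 - 2 * t ^ 7 / 6615 - t ^ 9 / 42525 - 2 * t ^ 11 / 1029105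
    - c * t ^ 13 / 13

lemma hasDerivAt_mulCotApproxPrimitive (c t : ℝ) :
    HasDerivAt (mulCotApproxPrimitive c) (mulCotApprox c t) t := by
  unfold mulCotApproxPrimitive mulCotApprox
  have h (n : ℕ) := hasDerivAt_pow (𝕜 := ℝ) n t
  refine (((((((hasDerivAt_id t).sub ((h 3).div_const 9)).sub ((h 5).div_const 225)).sub
    (((h 7).const_mul 2).div_const 6615)).sub ((h 9).div_const 42525)).sub
    (((h 11).const_mul 2).div_const 1029105)).sub
    (((h 13).const_mul c).div_const 13)).congr_deriv ?_
  push_cast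
  ring

lemma mulCotApprox_nonneg {c t : ℝ} (hc : c ≤ 1 / 1000) (ht2 : t ^ 2 ≤ 1.1) :
    0 ≤ mulCotApprox c t := by
  have h0 : 0 ≤ t ^ 2 := sq_nonneg t
  have h (n : ℕ) : t ^ (2 * n) ≤ 1.1 ^ n := by
    rw [pow_mul]; exact pow_le_pow_left₀ h0 ht2 n
  have h2 := h 2
  have h3 := h 3
  have h4 := h 4
  have h5 := h 5
  have h6 := h 6
  have h7 : c * t ^ 12 ≤ 1 / 1000 * t ^ 12 := by gcongr
  norm_num at h2 h3 h4 h5 h6 ht2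
  unfold mulCotApprox
  linarith

lemma mul_cos_le_mulCotApprox_mul_sin {t : ℝ} (ht : 0 ≤ t) (ht2 : t ^ 2 ≤ 1.1) :
    t * cos t ≤ mulCotApprox (21 / 10 ^ 7) t * sin t := by
  have hs : sinTaylor 8 t ≤ sin t := by
    have := neg_one_pow_succ_mul_sin_sub_sinTaylor_nonneg 7 ht
    norm_num at this; linarith
  have hc : cos t ≤ cosTaylor 7 t := by
    have := neg_one_pow_mul_cos_sub_cosTaylor_nonneg 6 ht
    norm_num at this; linarith
  have hP := mulCotApprox_nonneg (c := 21 / 10 ^ 7) (by norm_num) ht2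
  calc t * cos t ≤ t * cosTaylor 7 t := by gcongr
    _ ≤ mulCotApprox (21 / 10 ^ 7) t * sinTaylor 8 t := by
      have h (n : ℕ) : 0 ≤ t ^ n := pow_nonneg ht n
      have h' (n : ℕ) : 0 ≤ t ^ n * (1.1 - t ^ 2) := mul_nonneg (h n) (by linarith)
      simp only [mulCotApprox, sinTaylor, cosTaylor, Finset.sum_range_succ, Finset.sum_range_zero,
        Nat.factorial]
      norm_num
      linarith [h 13, h 15, h' 15, h 19, h' 19, h 23, h' 23, h 27]
    _ ≤ _ := by gcongr

lemma mulCotApprox_mul_sin_le_mul_cos {t : ℝ} (ht : 0 ≤ t) (ht2 : t ^ 2 ≤ 1.1) :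
    mulCotApprox (246 / 10 ^ 8) t * sin t ≤ t * cos t := by
  have hs : sin t ≤ sinTaylor 7 t := by
    have := neg_one_pow_succ_mul_sin_sub_sinTaylor_nonneg 6 ht
    norm_num at this; linarith
  have hc : cosTaylor 8 t ≤ cos t := by
    have := neg_one_pow_mul_cos_sub_cosTaylor_nonneg 7 ht
    norm_num at this; linarith
  have hP := mulCotApprox_nonneg (c := 246 / 10 ^ 8) (by norm_num) ht2
  calc mulCotApprox (246 / 10 ^ 8) t * sin t
      ≤ mulCotApprox (246 / 10 ^ 8) t * sinTaylor 7 t := by gcongr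
    _ ≤ t * cosTaylor 8 t := by
      have h (n : ℕ) : 0 ≤ t ^ n := pow_nonneg ht n
      have h' (n : ℕ) : 0 ≤ t ^ n * (1.1 - t ^ 2) := mul_nonneg (h n) (by linarith)
      simp only [mulCotApprox, sinTaylor, cosTaylor, Finset.sum_range_succ, Finset.sum_range_zero,
        Nat.factorial]
      norm_num
      linarith [h 13, h' 13, h 15, h' 15, h 17, h' 17, h 19, h' 19, h 21, h' 21, h 23, h' 23, h 25]
    _ ≤ _ := by gcongr

lemma continuousOn_mul_log_two_mul_sin {b : ℝ} (hb : b < π) :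
    ContinuousOn (fun t => t * log (2 * sin t)) (Icc 0 b) := by
  have hpos : ∀ t ∈ Icc 0 b, 0 < sinc t := by
    intro t ht
    rcases ht.1.eq_or_lt with rfl | h
    · simp
    · rw [sinc_of_ne_zero h.ne']
      exact div_pos (sin_pos_of_pos_of_lt_pi h (ht.2.trans_lt hb)) h
  have hc : ContinuousOn (fun t => t * log t + t * log (2 * sinc t)) (Icc 0 b) := by
    refine continuous_mul_log.continuousOn.add (continuousOn_id.mul (ContinuousOn.log ?_ ?_))
    · exact (continuous_const.mul continuous_sinc).continuousOn
    · intro t ht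
      have := hpos t ht
      positivity
  refine hc.congr fun t ht => ?_
  rcases ht.1.eq_or_lt with rfl | h
  · simp
  · have := hpos t ht
    dsimp only
    rw [← mul_add, ← log_mul h.ne' (by positivity), sinc_of_ne_zero h.ne']
    congr 2
    field_simp

lemma hasDerivAt_mul_log_two_mul_sin_sub {t : ℝ} (h : 0 < sin t) (c : ℝ) :
    HasDerivAt (fun t => t * log (2 * sin t) - mulCotApproxPrimitive c t)
      (log (2 * sin t) + (t * cos t / sin t - mulCotApprox c t)) t := by
  refine (((hasDerivAt_id t).mul (((hasDerivAt_sin t).const_mul 2).log (by positivity))).sub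
    (hasDerivAt_mulCotApproxPrimitive c t)).congr_deriv ?_
  simp only [id]
  field_simp
  ring

lemma integrableOn_log_two_mul_sin {b : ℝ} (hb : 0 ≤ b) :
    IntegrableOn (fun t => log (2 * sin t)) (Icc 0 b) := by
  have h : AnalyticOnNhd ℝ (fun t => 2 * sin t) (uIcc 0 b) := fun t _ =>
    analyticAt_const.mul analyticAt_sin
  exact (intervalIntegrable_iff_integrableOn_Icc_of_le hb).1
    h.meromorphicOn.intervalIntegrable_log

lemma lob_le {b : ℝ} (hb0 : 0 ≤ b) (hb : b < π) (hb2 : b ^ 2 ≤ 1.1) :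
    lob b ≤ mulCotApproxPrimitive (21 / 10 ^ 7) b - b * log (2 * sin b) := by
  have hsin : ∀ t ∈ Ioo 0 b, 0 < sin t := fun t ht =>
    sin_pos_of_pos_of_lt_pi ht.1 (ht.2.trans hb)
  have hcont (c : ℝ) : ContinuousOn (mulCotApproxPrimitive c) (Icc 0 b) := fun t _ =>
    (hasDerivAt_mulCotApproxPrimitive c t).continuousAt.continuousWithinAt
  have := intervalIntegral.sub_le_integral_of_hasDeriv_right_of_le hb0
    ((continuousOn_mul_log_two_mul_sin hb).sub (hcont _))
    (fun t ht => (hasDerivAt_mul_log_two_mul_sin_sub (hsin t ht) (21 / 10 ^ 7)).hasDerivWithinAt)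
    (integrableOn_log_two_mul_sin hb0) (fun t ht => by
      have h2 : t ^ 2 ≤ 1.1 := (pow_le_pow_left₀ ht.1.le ht.2.le 2).trans hb2
      have := (div_le_iff₀ (hsin t ht)).2 (mul_cos_le_mulCotApprox_mul_sin ht.1.le h2)
      linarith)
  simp [mulCotApproxPrimitive] at this
  simp only [lob, mulCotApproxPrimitive]
  linarith

lemma le_lob {b : ℝ} (hb0 : 0 ≤ b) (hb : b < π) (hb2 : b ^ 2 ≤ 1.1) :
    mulCotApproxPrimitive (246 / 10 ^ 8) b - b * log (2 * sin b) ≤ lob b := by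
  have hsin : ∀ t ∈ Ioo 0 b, 0 < sin t := fun t ht =>
    sin_pos_of_pos_of_lt_pi ht.1 (ht.2.trans hb)
  have hcont (c : ℝ) : ContinuousOn (mulCotApproxPrimitive c) (Icc 0 b) := fun t _ =>
    (hasDerivAt_mulCotApproxPrimitive c t).continuousAt.continuousWithinAt
  have := intervalIntegral.integral_le_sub_of_hasDeriv_right_of_le hb0
    ((continuousOn_mul_log_two_mul_sin hb).sub (hcont _))
    (fun t ht => (hasDerivAt_mul_log_two_mul_sin_sub (hsin t ht) (246 / 10 ^ 8)).hasDerivWithinAt)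
    (integrableOn_log_two_mul_sin hb0) (fun t ht => by
      have h2 : t ^ 2 ≤ 1.1 := (pow_le_pow_left₀ ht.1.le ht.2.le 2).trans hb2
      have := (le_div_iff₀ (hsin t ht)).2 (mulCotApprox_mul_sin_le_mul_cos ht.1.le h2)
      linarith)
  simp [mulCotApproxPrimitive] at this
  simp only [lob, mulCotApproxPrimitive]
  linarith

lemma log_two_mul_sin_pi_div_three : log (2 * sin (π / 3)) = log 3 / 2 := by
  rw [sin_pi_div_three, mul_div_cancel₀ _ two_ne_zero, log_sqrt (by norm_num)]

lemma vtet_bounds : 1.01494155 < vtet ∧ vtet < 1.01494175 := by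
  have hl : 1.0471975511 < π / 3 := by linarith [pi_gt_d20]
  have hu : π / 3 < 1.0471975512 := by linarith [pi_lt_d20]
  have h0 : 0 ≤ π / 3 := by positivity
  have hpi : π / 3 < π := by linarith [pi_pos]
  have h2 : (π / 3) ^ 2 ≤ 1.1 := by nlinarith
  have hup := lob_le h0 hpi h2
  have hlo := le_lob h0 hpi h2
  rw [log_two_mul_sin_pi_div_three] at hup hlo
  have hlogu : π / 3 * (log 3 / 2) ≤ 1.0471975512 * (1.0986122888 / 2) := by
    gcongr
    exact log_three_lt_d9.le
  have hlogl : 1.0471975511 * (1.0986122885 / 2) ≤ π / 3 * (log 3 / 2) := by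
    gcongr
    exact log_three_gt_d9.le
  have pl (n : ℕ) : (1.0471975511 : ℝ) ^ n ≤ (π / 3) ^ n := pow_le_pow_left₀ (by norm_num) hl.le n
  have pu (n : ℕ) : (π / 3) ^ n ≤ (1.0471975512 : ℝ) ^ n := pow_le_pow_left₀ h0 hu.le n
  unfold vtet
  simp only [mulCotApproxPrimitive] at hup hlo
  generalize π / 3 = b at *
  constructor
  · have h3 := pu 3
    have h5 := pu 5
    have h7 := pu 7
    have h9 := pu 9
    have h11 := pu 11
    have h13 := pu 13
    norm_num at *
    linarith
  · have h3 := pl 3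
    have h5 := pl 5
    have h7 := pl 7
    have h9 := pl 9
    have h11 := pl 11
    have h13 := pl 13
    norm_num at *
    linarith

lemma strictMonoOn_pow_five_sub_add_one_sq :
    StrictMonoOn (fun x : ℝ => x ^ 5 - (x + 1) ^ 2) (Ici 1) := by
  intro x hx y hy hxy
  rw [mem_Ici] at hx hy
  have h1 : 1 ≤ y ^ 4 := one_le_pow₀ hy
  have h2 : y ≤ y ^ 3 * x := by nlinarith [one_le_pow₀ hy (n := 2), one_le_pow₀ hy (n := 3)]
  have h3 : 1 ≤ y ^ 2 * x ^ 2 := one_le_mul_of_one_le_of_one_le (one_le_pow₀ hy) (one_le_pow₀ hx)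
  have h4 : x ≤ y * x ^ 3 := by nlinarith [one_le_pow₀ hx (n := 2), one_le_pow₀ hx (n := 3)]
  have h5 : 1 ≤ x ^ 4 := one_le_pow₀ hx
  have : 0 < (y - x) * (y ^ 4 + y ^ 3 * x + y ^ 2 * x ^ 2 + y * x ^ 3 + x ^ 4 - (x + y + 2)) :=
    mul_pos (by linarith) (by linarith)
  dsimp only
  linarith

lemma log_bounds_of_pow_five_eq {γ : ℝ} (hγ : 1 < γ) (hγ5 : γ ^ 5 = (γ + 1) ^ 2) :
    0.35438201 < log γ ∧ log γ < 0.35438203 := by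
  have hl : 1.42529957 < γ := by
    refine (strictMonoOn_pow_five_sub_add_one_sq.lt_iff_lt (by norm_num) hγ.le).1 ?_
    rw [hγ5]; norm_num
  have hu : γ < 1.42529958 := by
    refine (strictMonoOn_pow_five_sub_add_one_sq.lt_iff_lt hγ.le (by norm_num)).1 ?_
    rw [hγ5]; norm_num
  have key (a : ℝ) (ha : 0 < a) : log a = (log 2 + log (1 - (1 - a ^ 2 / 2))) / 2 := by
    rw [sub_sub_cancel, log_div (by positivity) two_ne_zero, log_pow]
    push_cast
    ring
  constructor
  · refine lt_trans ?_ (log_lt_log (by norm_num) hl)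
    have h := abs_log_sub_add_sum_range_le (x := 1 - 1.42529957 ^ 2 / 2) (by norm_num [abs_lt]) 5
    rw [key _ (by norm_num)]
    have h1 := log_two_gt_d9
    rw [abs_of_neg (a := 1 - 1.42529957 ^ 2 / 2) (by norm_num)] at h
    generalize log (1 - (1 - 1.42529957 ^ 2 / 2)) = L at *
    norm_num [Finset.sum_range_succ, abs_le] at h
    norm_num at h1 ⊢
    linarith
  · refine lt_trans (log_lt_log (by linarith) hu) ?_
    have h := abs_log_sub_add_sum_range_le (x := 1 - 1.42529958 ^ 2 / 2) (by norm_num [abs_lt]) 5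
    rw [key _ (by norm_num)]
    have h1 := log_two_lt_d9
    rw [abs_of_neg (a := 1 - 1.42529958 ^ 2 / 2) (by norm_num)] at h
    generalize log (1 - (1 - 1.42529958 ^ 2 / 2)) = L at *
    norm_num [Finset.sum_range_succ, abs_le] at h
    norm_num at h1 ⊢
    linarith

/-- Remark 2: `28.63975 < 10 v_tet / log γ < 28.63977`. -/
theorem stmt_14 (γ : ℝ) (hγ : 1 < γ) (hγ5 : γ ^ 5 = (γ + 1) ^ 2) :
    28.63975 < 10 * vtet / Real.log γ ∧ 10 * vtet / Real.log γ < 28.63977 := by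
  obtain ⟨hl, hu⟩ := log_bounds_of_pow_five_eq hγ hγ5
  obtain ⟨vl, vu⟩ := vtet_bounds
  have hpos : 0 < log γ := by linarith
  rw [lt_div_iff₀ hpos, div_lt_iff₀ hpos]
  constructor <;> linarith
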